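/- arXiv:1402.3900 — 3 statements merged into one kernel-verified Lean document; each statement's English description precedes it below -/
import Mathlib

section
/- Let D = B(0,R) be the open ball of radius R > 0 centered at the origin in EuclideanSpace ℝ (Fin n) with n ≥ 1. Then the heart of D is exactly the singleton {0}: ♥(B(0,R)) = {0}. -/
open scoped InnerProductSpace

variable {n : ℕ}

/-- `(v, c)` (with `v` a unit vector) is a hyperplane of interior reflection for `D` if both
open sides `{y ∈ D : ⟪y, v⟫ > c}` and `{y ∈ D : ⟪y, v⟫ < c}` of the hyperplane
`{y : ⟪y, v⟫ = c}` are nonempty and the reflection `σ_{v,c} : y ↦ y - 2(⟪y, v⟫ - c) • v`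
maps the side `{y ∈ D : ⟪y, v⟫ > c}` (the small side) into `D`. -/
def IsInteriorReflection (D : Set (EuclideanSpace ℝ (Fin n)))
    (v : EuclideanSpace ℝ (Fin n)) (c : ℝ) : Prop :=
  ‖v‖ = 1 ∧
  {y ∈ D | c < ⟪y, v⟫_ℝ}.Nonempty ∧
  {y ∈ D | ⟪y, v⟫_ℝ < c}.Nonempty ∧
  (fun y => y - (2 * (⟪y, v⟫_ℝ - c)) • v) '' {y ∈ D | c < ⟪y, v⟫_ℝ} ⊆ D

/-- The heart `♥(D)` of `D`: the set of points of `D` lying, for every hyperplane of interior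
reflection `(v, c)` of `D`, in the closed big-side half-space `{y : ⟪y, v⟫ ≤ c}`. -/
def heart (D : Set (EuclideanSpace ℝ (Fin n))) : Set (EuclideanSpace ℝ (Fin n)) :=
  D ∩ ⋂ (v : EuclideanSpace ℝ (Fin n)) (c : ℝ) (_ : IsInteriorReflection D v c),
      {y | ⟪y, v⟫_ℝ ≤ c}

theorem norm_sub_smul_sq {E : Type*} [NormedAddCommGroup E] [InnerProductSpace ℝ E]
    {v : E} (hv : ‖v‖ = 1) (c : ℝ) (y : E) :
    ‖y - (2 * (⟪y, v⟫_ℝ - c)) • v‖ ^ 2 = ‖y‖ ^ 2 - 4 * c * (⟪y, v⟫_ℝ - c) := by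
  rw [norm_sub_sq_real, inner_smul_right, norm_smul, hv, mul_one, Real.norm_eq_abs, sq_abs]
  ring

/-- Reflections of a ball centered at the origin are interior for every offset `c ∈ [0, R)`. -/
theorem isInteriorReflection_ball {v : EuclideanSpace ℝ (Fin n)} (hv : ‖v‖ = 1) {c R : ℝ}
    (hc : 0 ≤ c) (hcR : c < R) :
    IsInteriorReflection (Metric.ball (0 : EuclideanSpace ℝ (Fin n)) R) v c := by
  have mem_ball_smul (s : ℝ) (hs : |s| < R) :
      s • v ∈ Metric.ball (0 : EuclideanSpace ℝ (Fin n)) R := by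
    simpa [norm_smul, hv] using hs
  have inner_smul_self (s : ℝ) : ⟪s • v, v⟫_ℝ = s := by
    simp [real_inner_smul_left, hv]
  refine ⟨hv, ⟨((c + R) / 2) • v, mem_ball_smul _ ?_, ?_⟩,
    ⟨((c - R) / 2) • v, mem_ball_smul _ ?_, ?_⟩, ?_⟩
  · rw [abs_lt]; constructor <;> linarith
  · rw [inner_smul_self]; linarith
  · rw [abs_lt]; constructor <;> linarith
  · rw [inner_smul_self]; linarith
  · rintro _ ⟨y, ⟨hy, hcy⟩, rfl⟩
    rw [mem_ball_zero_iff] at hy ⊢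
    refine lt_of_le_of_lt (abs_le_of_sq_le_sq' ?_ (norm_nonneg y)).2 hy
    rw [norm_sub_smul_sq hv]
    linarith [mul_nonneg hc (sub_nonneg.2 hcy.le)]

/-- A hyperplane of interior reflection of a ball centered at the origin has nonnegative offset. -/
theorem IsInteriorReflection.nonneg_of_ball {v : EuclideanSpace ℝ (Fin n)} {c R : ℝ} (hR : 0 < R)
    (h : IsInteriorReflection (Metric.ball (0 : EuclideanSpace ℝ (Fin n)) R) v c) : 0 ≤ c := by
  obtain ⟨hv, -, -, hsub⟩ := h
  by_contra! hc
  set s : ℝ := max 0 (R + 2 * c)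
  have hs0 : 0 ≤ s := le_max_left _ _
  have hsR : s < R := max_lt hR (by linarith)
  have hs2 : R + 2 * c ≤ s := le_max_right _ _
  have hin : ⟪s • v, v⟫_ℝ = s := by simp [real_inner_smul_left, hv]
  have hmem := hsub ⟨s • v, ⟨by simpa [norm_smul, hv, abs_of_nonneg hs0] using hsR,
    by rw [hin]; linarith⟩, rfl⟩
  simp only [hin, ← sub_smul, mem_ball_zero_iff, norm_smul, hv, mul_one, Real.norm_eq_abs,
    abs_lt] at hmem
  linarith [hmem.1]

/-- The heart of the ball `B(0,R)` in `EuclideanSpace ℝ (Fin n)` (with `n ≥ 1`, `R > 0`) is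
exactly the singleton `{0}`. -/
theorem heart_ball_eq_singleton (hn : 1 ≤ n) (R : ℝ) (hR : 0 < R) :
    heart (Metric.ball (0 : EuclideanSpace ℝ (Fin n)) R) = {0} := by
  ext x
  simp only [heart, Set.mem_inter_iff, Set.mem_iInter, Set.mem_ofPred_eq, Set.mem_singleton_iff]
  constructor
  · rintro ⟨hx, hheart⟩
    by_contra hx0
    have hpos : 0 < ‖x‖ := norm_pos_iff.2 hx0
    rw [mem_ball_zero_iff] at hx
    have hle := hheart (‖x‖⁻¹ • x) (‖x‖ / 2)
      (isInteriorReflection_ball (norm_smul_inv_norm (𝕜 := ℝ) hx0) (by positivity) (by linarith))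
    rw [real_inner_smul_right, real_inner_self_eq_norm_sq, pow_two,
      inv_mul_cancel_left₀ hpos.ne'] at hle
    linarith
  · rintro rfl
    refine ⟨Metric.mem_ball_self hR, fun v c h => ?_⟩
    rw [inner_zero_left]
    exact h.nonneg_of_ball hR
end

section
/- Let D be a nonempty bounded convex open subset of EuclideanSpace ℝ (Fin n). Then the heart ♥(D) is nonempty. -/
open scoped InnerProductSpace

variable {n : ℕ}

open MeasureTheory

/-- The average of the identity over a nonempty bounded convex open set lies in that set. -/
theorem setAverage_id_mem_of_isOpen {D : Set (EuclideanSpace ℝ (Fin n))}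
    (hne : D.Nonempty) (hbd : Bornology.IsBounded D) (hconv : Convex ℝ D) (hop : IsOpen D)
    (hint : IntegrableOn (fun y => y) D) : (⨍ y in D, y) ∈ D := by
  obtain ⟨x, hx⟩ := hne
  obtain ⟨r, hr, hball⟩ := Metric.nhds_basis_closedBall.mem_iff.1 (hop.mem_nhds hx)
  have : IsFiniteMeasure (volume.restrict D) := ⟨by simpa using hbd.measure_lt_top⟩
  have hpos : volume.restrict D (Metric.closedBall x r) ≠ 0 := by
    rw [Measure.restrict_eq_self _ hball]
    exact (Metric.measure_closedBall_pos volume x hr).ne'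
  suffices h : (⨍ y in D, y) ∈ interior D from interior_subset h
  refine hconv.average_mem_interior_of_set hpos (ae_restrict_mem hop.measurableSet) hint ?_
  rw [hop.interior_eq]
  exact hball ((convex_closedBall x r).set_average_mem Metric.isClosed_closedBall hpos
    (measure_ne_top _ _) (ae_restrict_mem measurableSet_closedBall) hint.integrableOn)

/-- Reflection across an affine hyperplane preserves Lebesgue measure. -/
theorem measurePreserving_affineReflection {v : EuclideanSpace ℝ (Fin n)} (hv : ‖v‖ = 1) (c : ℝ) :
    MeasurePreserving (fun y : EuclideanSpace ℝ (Fin n) => y - (2 * (⟪y, v⟫_ℝ - c)) • v) := by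
  have key : (fun y : EuclideanSpace ℝ (Fin n) => y - (2 * (⟪y, v⟫_ℝ - c)) • v) =
      (fun y => y + (2 * c) • v) ∘ ((ℝ ∙ v)ᗮ.reflection) := by
    funext y
    simp only [Function.comp_apply, Submodule.reflection_orthogonal_apply,
      Submodule.reflection_singleton_apply, hv, real_inner_comm v y]
    norm_num
    module
  rw [key]
  exact (measurePreserving_add_right volume _).comp (LinearIsometryEquiv.measurePreserving _)

/-- The integral of the signed distance to a hyperplane of interior reflection, over the whole
set, is nonpositive. -/
theorem IsInteriorReflection.setIntegral_inner_sub_nonpos {D : Set (EuclideanSpace ℝ (Fin n))}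
    {v : EuclideanSpace ℝ (Fin n)} {c : ℝ} (h : IsInteriorReflection D v c) (hD : MeasurableSet D)
    (hint : IntegrableOn (fun y => ⟪y, v⟫_ℝ - c) D) :
    ∫ y in D, (⟪y, v⟫_ℝ - c) ≤ 0 := by
  obtain ⟨hv, -, -, hrefl⟩ := h
  set σ : EuclideanSpace ℝ (Fin n) → EuclideanSpace ℝ (Fin n) :=
    fun y => y - (2 * (⟪y, v⟫_ℝ - c)) • v with hσ
  set g := D.indicator fun y => ⟪y, v⟫_ℝ - c with hg
  have hmp : MeasurePreserving σ := measurePreserving_affineReflection hv c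
  have hdist (y) : ⟪σ y, v⟫_ℝ - c = -(⟪y, v⟫_ℝ - c) := by
    simp only [hσ, inner_sub_left, inner_smul_left, real_inner_self_eq_norm_sq, hv]
    simp
    ring
  have hinv (y) : σ (σ y) = y := by
    change σ y - (2 * (⟪σ y, v⟫_ℝ - c)) • v = y
    rw [hdist]
    simp only [hσ]
    module
  have hgi : Integrable g := (integrable_indicator_iff hD).2 hint
  have hcomp : ∫ y, g (σ y) = ∫ y, g y := by
    have hg' : AEStronglyMeasurable g (Measure.map σ volume) := by
      rw [hmp.map_eq]; exact hgi.aestronglyMeasurable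
    rw [← integral_map hmp.measurable.aemeasurable hg', hmp.map_eq]
  have hmem {y} (hy : y ∈ D) (hc : 0 < ⟪y, v⟫_ℝ - c) : σ y ∈ D :=
    hrefl ⟨y, ⟨hy, sub_pos.1 hc⟩, rfl⟩
  have hle (y) : g y + g (σ y) ≤ 0 := by
    classical
    have hd := hdist y
    have hmem' : σ y ∈ D → 0 < ⟪σ y, v⟫_ℝ - c → y ∈ D := fun h h' => hinv y ▸ hmem h h'
    simp only [hg, Set.indicator_apply]
    split_ifs with hy hy' hy'
    · linarith
    · by_contra! hcon
      exact hy' (hmem hy (by linarith))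
    · by_contra! hcon
      exact hy (hmem' hy' (by linarith))
    · simp
  have hsum : ∫ y, (g y + g (σ y)) ≤ 0 := integral_nonpos hle
  have hgσ : Integrable fun y => g (σ y) := hmp.integrable_comp_of_integrable hgi
  rw [integral_add hgi hgσ, hcomp] at hsum
  rw [← integral_indicator hD]
  linarith

/-- The heart of a nonempty bounded convex open subset of Euclidean space is nonempty. -/
theorem heart_nonempty (D : Set (EuclideanSpace ℝ (Fin n)))
    (hne : D.Nonempty) (hbd : Bornology.IsBounded D) (hconv : Convex ℝ D)
    (hop : IsOpen D) : (heart D).Nonempty := by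
  have hfin : volume D < ⊤ := hbd.measure_lt_top
  have hint : IntegrableOn (fun y : EuclideanSpace ℝ (Fin n) => y) D := by
    obtain ⟨R, hR⟩ := hbd.exists_norm_le
    exact Measure.integrableOn_of_bounded hfin.ne aestronglyMeasurable_id
      ((ae_restrict_mem hop.measurableSet).mono hR)
  have hpos : 0 < volume.real D :=
    ENNReal.toReal_pos (hop.measure_pos volume hne).ne' hfin.ne
  refine ⟨⨍ y in D, y, setAverage_id_mem_of_isOpen hne hbd hconv hop hint, ?_⟩
  simp only [Set.mem_iInter]
  intro v c h
  have hinner : IntegrableOn (fun y => ⟪y, v⟫_ℝ) D := hint.inner_const v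
  have hc : IntegrableOn (fun _ : EuclideanSpace ℝ (Fin n) => c) D :=
    integrableOn_const hfin.ne
  have hle := h.setIntegral_inner_sub_nonpos hop.measurableSet (hinner.sub hc)
  have hcomm : ∫ y in D, ⟪y, v⟫_ℝ = ⟪∫ y in D, y, v⟫_ℝ := by
    simp only [real_inner_comm v]
    exact (integral_inner hint v)
  rw [integral_sub hinner hc, setIntegral_const, hcomm, smul_eq_mul] at hle
  change ⟪⨍ y in D, y, v⟫_ℝ ≤ c
  rw [setAverage_eq, real_inner_smul_left, inv_mul_le_iff₀ hpos]
  linarith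
end

section
/- Let λ, μ : ℕ → ℝ with λ k > 0 and μ k > 0 for all k, and let s > 0 be a real number such that both Σ_k (λ k)^{-s} and Σ_k (μ k)^{-s} converge. If Σ_k exp(-(λ k)·t) ≤ Σ_k exp(-(μ k)·t) for every t > 0 (both series converging), then Σ_k (λ k)^{-s} ≤ Σ_k (μ k)^{-s}. -/
open MeasureTheory Set in
/-- The Gamma integral, as a lower Lebesgue integral. -/
lemma lintegral_rpow_mul_exp_neg_mul_Ioi {a s : ℝ} (ha : 0 < a) (hs : 0 < s) :
    ∫⁻ t in Ioi (0 : ℝ), ENNReal.ofReal (t ^ (s - 1) * Real.exp (-a * t)) =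
      ENNReal.ofReal (Real.Gamma s * a ^ (-s)) := by
  have key := Real.integral_rpow_mul_exp_neg_mul_Ioi hs ha
  simp only [← neg_mul, one_div, Real.inv_rpow ha.le, ← Real.rpow_neg ha.le] at key
  have hne : a ^ (-s) * Real.Gamma s ≠ 0 :=
    (mul_pos (Real.rpow_pos_of_pos ha _) (Real.Gamma_pos_of_pos hs)).ne'
  rw [mul_comm (Real.Gamma s), ← key, ofReal_integral_eq_lintegral_ofReal
    (Integrable.of_integral_ne_zero (by rwa [key]))]
  filter_upwards [ae_restrict_mem measurableSet_Ioi] with t (ht : 0 < t)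
  positivity

open MeasureTheory Set in
/-- The Mellin transform of a heat trace is the Gamma function times the zeta value. -/
lemma lintegral_rpow_mul_tsum_exp_neg_mul_Ioi {a : ℕ → ℝ} {s : ℝ} (ha : ∀ k, 0 < a k)
    (hs : 0 < s) (hsum : Summable fun k => a k ^ (-s))
    (hexp : ∀ t : ℝ, 0 < t → Summable fun k => Real.exp (-(a k) * t)) :
    ∫⁻ t in Ioi (0 : ℝ), ENNReal.ofReal (t ^ (s - 1) * ∑' k, Real.exp (-(a k) * t)) =
      ENNReal.ofReal (Real.Gamma s * ∑' k, a k ^ (-s)) := by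
  have hΓ := Real.Gamma_pos_of_pos hs
  calc
    _ = ∫⁻ t in Ioi (0 : ℝ), ∑' k, ENNReal.ofReal (t ^ (s - 1) * Real.exp (-(a k) * t)) := by
      refine setLIntegral_congr_fun measurableSet_Ioi fun t (ht : 0 < t) => ?_
      rw [← tsum_mul_left, ENNReal.ofReal_tsum_of_nonneg (fun k => by positivity)
        ((hexp t ht).mul_left _)]
    _ = ∑' k, ENNReal.ofReal (Real.Gamma s * a k ^ (-s)) := by
      rw [lintegral_tsum fun k => by fun_prop]
      exact tsum_congr fun k => lintegral_rpow_mul_exp_neg_mul_Ioi (ha k) hs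
    _ = _ := by
      rw [← tsum_mul_left, ENNReal.ofReal_tsum_of_nonneg
        (fun k => mul_nonneg hΓ.le (Real.rpow_nonneg (ha k).le _)) (hsum.mul_left _)]

/-- The zeta function is an order-preserving transform of the heat trace: if the heat
traces satisfy `Σ_k exp(-(λ k) t) ≤ Σ_k exp(-(μ k) t)` for all `t > 0` (both series
converging), then the zeta values satisfy `Σ_k (λ k)⁻ˢ ≤ Σ_k (μ k)⁻ˢ`. -/
theorem zeta_le_of_heat_trace_le (lam mu : ℕ → ℝ)
    (hlam : ∀ k, 0 < lam k) (hmu : ∀ k, 0 < mu k)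
    (s : ℝ) (hs : 0 < s)
    (hlamsum : Summable fun k => (lam k) ^ (-s))
    (hmusum : Summable fun k => (mu k) ^ (-s))
    (hheat : ∀ t : ℝ, 0 < t →
      (Summable fun k => Real.exp (-(lam k) * t)) ∧
      (Summable fun k => Real.exp (-(mu k) * t)) ∧
      ∑' k, Real.exp (-(lam k) * t) ≤ ∑' k, Real.exp (-(mu k) * t)) :
    ∑' k, (lam k) ^ (-s) ≤ ∑' k, (mu k) ^ (-s) := by
  have hΓ := Real.Gamma_pos_of_pos hs
  refine le_of_mul_le_mul_left ?_ hΓ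
  rw [← ENNReal.ofReal_le_ofReal_iff
      (mul_nonneg hΓ.le (tsum_nonneg fun k => Real.rpow_nonneg (hmu k).le _)),
    ← lintegral_rpow_mul_tsum_exp_neg_mul_Ioi hlam hs hlamsum fun t ht => (hheat t ht).1,
    ← lintegral_rpow_mul_tsum_exp_neg_mul_Ioi hmu hs hmusum fun t ht => (hheat t ht).2.1]
  refine MeasureTheory.setLIntegral_mono' measurableSet_Ioi fun t (ht : 0 < t) => ?_
  exact ENNReal.ofReal_le_ofReal
    (mul_le_mul_of_nonneg_left (hheat t ht).2.2 (Real.rpow_nonneg ht.le _))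
end
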